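/- Let X* be the capacity-achieving input of the amplitude-constrained AWGN channel with constraint A > 1. Then the density of the wrapped output ⟨X*+Z⟩_A on (-π, π) is bounded: sup_θ f_{⟨X*+Z⟩_A}(θ) ≤ (e/(2π))(3 + √π/(√2 A)) ≤ 5e/(2π). -/

import Mathlib

open Real MeasureTheory

noncomputable def stdNormalPdf (t : ℝ) : ℝ := (Real.sqrt (2 * π))⁻¹ * Real.exp (-t ^ 2 / 2)

/-- Output density of the AWGN channel under input distribution `Q`. -/
noncomputable def outDen (Q : Measure ℝ) (y : ℝ) : ℝ := ∫ x, stdNormalPdf (y - x) ∂Q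

/-- Mutual information `I(X; X+Z)` for input distribution `Q` on the AWGN channel. -/
noncomputable def awgnMI (Q : Measure ℝ) : ℝ :=
  ∫ x, (∫ y : ℝ, stdNormalPdf (y - x) * Real.log (stdNormalPdf (y - x) / outDen Q y)) ∂Q


lemma stdNormalPdf_sub_eq_gaussianPDFReal (x y : ℝ) :
    stdNormalPdf (y - x) = ProbabilityTheory.gaussianPDFReal x 1 y := by
  simp [stdNormalPdf, ProbabilityTheory.gaussianPDFReal]

lemma continuous_stdNormalPdf : Continuous stdNormalPdf := by
  unfold stdNormalPdf; fun_prop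

lemma one_le_sqrt_two_pi : 1 ≤ √(2 * π) := by
  rw [Real.one_le_sqrt]; nlinarith [Real.pi_gt_three]

lemma stdNormalPdf_pos (t : ℝ) : 0 < stdNormalPdf t := by
  have := one_le_sqrt_two_pi
  unfold stdNormalPdf; positivity

lemma stdNormalPdf_le_exp (t : ℝ) : stdNormalPdf t ≤ Real.exp (-t ^ 2 / 2) :=
  mul_le_of_le_one_left (Real.exp_pos _).le (inv_le_one_of_one_le₀ one_le_sqrt_two_pi)

lemma stdNormalPdf_le_one (t : ℝ) : stdNormalPdf t ≤ 1 :=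
  (stdNormalPdf_le_exp t).trans (Real.exp_le_one_iff.2 (by nlinarith [sq_nonneg t]))

lemma log_stdNormalPdf (t : ℝ) :
    Real.log (stdNormalPdf t) = -Real.log (√(2 * π)) - t ^ 2 / 2 := by
  have := one_le_sqrt_two_pi
  rw [stdNormalPdf, Real.log_mul (by positivity) (by positivity), Real.log_inv, Real.log_exp]
  ring

lemma stdNormalPdf_eq_mul_exp (s t : ℝ) :
    stdNormalPdf s = stdNormalPdf t * Real.exp ((t ^ 2 - s ^ 2) / 2) := by
  rw [stdNormalPdf, stdNormalPdf, mul_assoc, ← Real.exp_add]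
  congr 2; ring

lemma stdNormalPdf_sub_le {A x : ℝ} (hx : x ∈ Set.Icc (-A) A) (y : ℝ) :
    stdNormalPdf (y - x) ≤ Real.exp (A ^ 2 / 2) * Real.exp (-(1 / 4) * y ^ 2) := by
  refine (stdNormalPdf_le_exp _).trans ?_
  rw [← Real.exp_add]
  apply Real.exp_le_exp.2
  nlinarith [sq_nonneg (y - 2 * x), sq_le_sq' hx.1 hx.2]

lemma integrable_stdNormalPdf_mul {μ : Measure ℝ} [IsFiniteMeasure μ] {A : ℝ}
    (hμ : ∀ᵐ x ∂μ, x ∈ Set.Icc (-A) A) {F : ℝ → ℝ} (hF : Continuous F) {a b : ℝ}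
    (hFb : ∀ y, |F y| ≤ a + b * y ^ 2) :
    Integrable (fun p : ℝ × ℝ => stdNormalPdf (p.2 - p.1) * F p.2) (μ.prod volume) := by
  have h0 : Integrable (fun y : ℝ => Real.exp (-(1 / 4) * y ^ 2)) :=
    integrable_exp_neg_mul_sq (by norm_num)
  have h2 : Integrable (fun y : ℝ => y ^ (2 : ℝ) * Real.exp (-(1 / 4) * y ^ 2)) :=
    integrable_rpow_mul_exp_neg_mul_sq (by norm_num) (by norm_num)
  have hD : Integrable (fun y : ℝ =>
      Real.exp (A ^ 2 / 2) * Real.exp (-(1 / 4) * y ^ 2) * (a + b * y ^ 2)) := by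
    refine ((h0.const_mul (Real.exp (A ^ 2 / 2) * a)).add
      (h2.const_mul (Real.exp (A ^ 2 / 2) * b))).congr (.of_forall fun y => ?_)
    simp only [Pi.add_apply, Real.rpow_two]
    ring
  refine (hD.comp_snd μ).mono' ?_ ?_
  · exact ((continuous_stdNormalPdf.comp (continuous_snd.sub continuous_fst)).mul
      (hF.comp continuous_snd)).aestronglyMeasurable
  · filter_upwards [Measure.quasiMeasurePreserving_fst.ae hμ] with p hp
    rw [Real.norm_eq_abs, abs_mul, abs_of_pos (stdNormalPdf_pos _)]
    exact mul_le_mul (stdNormalPdf_sub_le hp _) (hFb _) (abs_nonneg _) (by positivity)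

lemma integrable_outDen_mul {μ : Measure ℝ} [IsFiniteMeasure μ] {A : ℝ}
    (hμ : ∀ᵐ x ∂μ, x ∈ Set.Icc (-A) A) {F : ℝ → ℝ} (hF : Continuous F) {a b : ℝ}
    (hFb : ∀ y, |F y| ≤ a + b * y ^ 2) :
    Integrable (fun y => outDen μ y * F y) := by
  simpa [outDen, integral_mul_const] using
    (integrable_stdNormalPdf_mul hμ hF hFb).integral_prod_right

lemma integral_outDen_mul {μ : Measure ℝ} [IsFiniteMeasure μ] {A : ℝ}
    (hμ : ∀ᵐ x ∂μ, x ∈ Set.Icc (-A) A) {F : ℝ → ℝ} (hF : Continuous F) {a b : ℝ}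
    (hFb : ∀ y, |F y| ≤ a + b * y ^ 2) :
    ∫ y, outDen μ y * F y = ∫ x, ∫ y, stdNormalPdf (y - x) * F y ∂volume ∂μ := by
  rw [integral_integral_swap (integrable_stdNormalPdf_mul hμ hF hFb)]
  simp [outDen, integral_mul_const]

lemma integral_stdNormalPdf_sub (x : ℝ) : ∫ y, stdNormalPdf (y - x) = 1 := by
  simp only [stdNormalPdf_sub_eq_gaussianPDFReal]
  exact ProbabilityTheory.integral_gaussianPDFReal_eq_one x one_ne_zero

lemma integrable_of_continuous_of_ae_mem_Icc {μ : Measure ℝ} [IsFiniteMeasure μ] {A : ℝ}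
    (hμ : ∀ᵐ x ∂μ, x ∈ Set.Icc (-A) A) {h : ℝ → ℝ} (hh : Continuous h) : Integrable h μ := by
  obtain ⟨C, hC⟩ := isCompact_Icc.exists_bound_of_continuousOn
    (s := Set.Icc (-A) A) hh.continuousOn
  refine Integrable.of_bound hh.aestronglyMeasurable C ?_
  filter_upwards [hμ] with x hx using hC x hx

lemma continuous_stdNormalPdf_sub (y : ℝ) : Continuous fun x => stdNormalPdf (y - x) :=
  continuous_stdNormalPdf.comp (by fun_prop)

lemma integrable_stdNormalPdf_sub (μ : Measure ℝ) [IsFiniteMeasure μ] (y : ℝ) :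
    Integrable (fun x => stdNormalPdf (y - x)) μ :=
  Integrable.of_bound (continuous_stdNormalPdf_sub y).aestronglyMeasurable 1
    (.of_forall fun x => by
      rw [Real.norm_eq_abs, abs_of_pos (stdNormalPdf_pos _)]
      exact stdNormalPdf_le_one _)

lemma continuous_outDen (μ : Measure ℝ) [IsFiniteMeasure μ] : Continuous (outDen μ) := by
  unfold outDen
  refine continuous_of_dominated (bound := fun _ => (1 : ℝ))
    (fun y => (continuous_stdNormalPdf_sub y).aestronglyMeasurable) (fun y => .of_forall fun x => ?_)
    (integrable_const _)
    (.of_forall fun x => continuous_stdNormalPdf.comp (by fun_prop))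
  rw [Real.norm_eq_abs, abs_of_pos (stdNormalPdf_pos _)]
  exact stdNormalPdf_le_one _

lemma outDen_le_one (μ : Measure ℝ) [IsProbabilityMeasure μ] (y : ℝ) : outDen μ y ≤ 1 := by
  have := integral_mono (integrable_stdNormalPdf_sub μ y) (integrable_const (1 : ℝ))
    (fun x => stdNormalPdf_le_one _)
  simpa [outDen] using this

lemma exp_le_outDen {μ : Measure ℝ} [IsProbabilityMeasure μ] {A : ℝ}
    (hμ : ∀ᵐ x ∂μ, x ∈ Set.Icc (-A) A) (y : ℝ) :
    Real.exp (-(Real.log (√(2 * π)) + A ^ 2 + y ^ 2)) ≤ outDen μ y := by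
  have := integral_mono_ae (integrable_const (Real.exp (-(Real.log (√(2 * π)) + A ^ 2 + y ^ 2))))
    (integrable_stdNormalPdf_sub μ y) (by
      filter_upwards [hμ] with x hx
      rw [← Real.exp_log (stdNormalPdf_pos (y - x)), log_stdNormalPdf]
      apply Real.exp_le_exp.2
      nlinarith [sq_nonneg (y + x), sq_le_sq' hx.1 hx.2])
  simpa [outDen] using this

lemma outDen_pos {μ : Measure ℝ} [IsProbabilityMeasure μ] {A : ℝ}
    (hμ : ∀ᵐ x ∂μ, x ∈ Set.Icc (-A) A) (y : ℝ) : 0 < outDen μ y :=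
  (Real.exp_pos _).trans_le (exp_le_outDen hμ y)

lemma abs_log_outDen_le {μ : Measure ℝ} [IsProbabilityMeasure μ] {A : ℝ}
    (hμ : ∀ᵐ x ∂μ, x ∈ Set.Icc (-A) A) (y : ℝ) :
    |Real.log (outDen μ y)| ≤ (Real.log (√(2 * π)) + A ^ 2) + 1 * y ^ 2 := by
  rw [abs_of_nonpos (Real.log_nonpos (outDen_pos hμ y).le (outDen_le_one μ y))]
  have := Real.log_le_log (Real.exp_pos _) (exp_le_outDen hμ y)
  rw [Real.log_exp] at this
  linarith

lemma continuous_log_outDen {μ : Measure ℝ} [IsProbabilityMeasure μ] {A : ℝ}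
    (hμ : ∀ᵐ x ∂μ, x ∈ Set.Icc (-A) A) : Continuous fun y => Real.log (outDen μ y) :=
  (continuous_outDen μ).log fun y => (outDen_pos hμ y).ne'

lemma integrable_outDen {μ : Measure ℝ} [IsProbabilityMeasure μ] {A : ℝ}
    (hμ : ∀ᵐ x ∂μ, x ∈ Set.Icc (-A) A) : Integrable (outDen μ) := by
  simpa using integrable_outDen_mul hμ (F := fun _ => 1) continuous_const (a := 1) (b := 0)
    (by simp)

lemma integral_outDen {μ : Measure ℝ} [IsProbabilityMeasure μ] {A : ℝ}
    (hμ : ∀ᵐ x ∂μ, x ∈ Set.Icc (-A) A) : ∫ y, outDen μ y = 1 := by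
  simpa [integral_stdNormalPdf_sub] using
    integral_outDen_mul hμ (F := fun _ => 1) continuous_const (a := 1) (b := 0) (by simp)

lemma integrable_stdNormalPdf_sub_mul (x : ℝ) {F : ℝ → ℝ} (hF : Continuous F) {a b : ℝ}
    (hFb : ∀ y, |F y| ≤ a + b * y ^ 2) : Integrable (fun y => stdNormalPdf (y - x) * F y) := by
  have h : ∀ᵐ z ∂(Measure.dirac x), z ∈ Set.Icc (-|x|) |x| := by
    rw [ae_dirac_eq]
    exact abs_le.1 le_rfl
  simpa [outDen] using integrable_outDen_mul h hF hFb

lemma awgnMI_eq {μ : Measure ℝ} [IsProbabilityMeasure μ] {A : ℝ}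
    (hμ : ∀ᵐ x ∂μ, x ∈ Set.Icc (-A) A) :
    awgnMI μ = (∫ z, stdNormalPdf z * Real.log (stdNormalPdf z)) -
      ∫ y, outDen μ y * Real.log (outDen μ y) := by
  have hc := continuous_log_outDen hμ
  have hb := abs_log_outDen_le hμ
  have hφ : Integrable fun z => stdNormalPdf z * Real.log (stdNormalPdf z) := by
    have hl : Continuous fun z => Real.log (stdNormalPdf z) :=
      continuous_stdNormalPdf.log fun z => (stdNormalPdf_pos z).ne'
    have := integrable_stdNormalPdf_sub_mul 0 hl (a := |Real.log (√(2 * π))|) (b := 1 / 2)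
      (fun y => by
        rw [log_stdNormalPdf]
        refine (abs_sub _ _).trans ?_
        rw [abs_neg, abs_of_nonneg (by positivity : 0 ≤ y ^ 2 / 2)]
        linarith)
    simpa using this
  have inner : ∀ x, ∫ y, stdNormalPdf (y - x) * Real.log (stdNormalPdf (y - x) / outDen μ y) =
      (∫ z, stdNormalPdf z * Real.log (stdNormalPdf z)) -
        ∫ y, stdNormalPdf (y - x) * Real.log (outDen μ y) := by
    intro x
    rw [← integral_sub_right_eq_self (fun z => stdNormalPdf z * Real.log (stdNormalPdf z)) x,
      ← integral_sub (hφ.comp_sub_right x) (integrable_stdNormalPdf_sub_mul x hc hb)]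
    congr 1 with y
    rw [Real.log_div (stdNormalPdf_pos _).ne' (outDen_pos hμ y).ne']
    ring
  rw [awgnMI, integral_outDen_mul hμ hc hb]
  simp only [inner]
  rw [integral_sub (integrable_const _) (integrable_stdNormalPdf_mul hμ hc hb).integral_prod_left]
  simp

lemma integral_quadratic {ν : Measure ℝ} [IsProbabilityMeasure ν] (h1 : Integrable (fun x => x) ν)
    (h2 : Integrable (fun x => x ^ 2) ν) (a b c : ℝ) :
    ∫ x, (a + b * x + c * x ^ 2) ∂ν = a + b * ∫ x, x ∂ν + c * ∫ x, x ^ 2 ∂ν := by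
  have h3 : Integrable (fun x => a + b * x) ν := (integrable_const a).add (h1.const_mul b)
  rw [integral_add h3 (h2.const_mul c), integral_add (integrable_const a) (h1.const_mul b),
    integral_const_mul, integral_const_mul]
  simp

lemma integral_stdNormalPdf_sub_mul_quadratic (x c d : ℝ) :
    ∫ u, stdNormalPdf (u - x) * (c + d * u - u ^ 2 / 2) = c + d * x - (x ^ 2 + 1) / 2 := by
  have hm : MemLp id 2 (ProbabilityTheory.gaussianReal x 1) :=
    ProbabilityTheory.memLp_id_gaussianReal 2
  have h1 : Integrable (fun u : ℝ => u) (ProbabilityTheory.gaussianReal x 1) :=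
    hm.integrable (by norm_num)
  have h2 : Integrable (fun u : ℝ => u ^ 2) (ProbabilityTheory.gaussianReal x 1) :=
    hm.integrable_sq
  have hv := ProbabilityTheory.variance_eq_sub hm
  rw [ProbabilityTheory.variance_id_gaussianReal] at hv
  simp only [Pi.pow_apply, id, ProbabilityTheory.integral_id_gaussianReal, NNReal.coe_one] at hv
  have := ProbabilityTheory.integral_gaussianReal_eq_integral_smul (μ := x) (v := 1)
    (f := fun u : ℝ => c + d * u - u ^ 2 / 2) one_ne_zero
  simp only [stdNormalPdf_sub_eq_gaussianPDFReal, smul_eq_mul] at this ⊢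
  have e : ∀ u : ℝ, c + d * u - u ^ 2 / 2 = c + d * u + (-1 / 2) * u ^ 2 := fun u => by ring
  rw [← this]
  simp only [e]
  rw [integral_quadratic h1 h2, ProbabilityTheory.integral_id_gaussianReal]
  linarith

section Reweighting

variable {μ : Measure ℝ} {w : ℝ → ℝ}

lemma integral_withDensity_ofReal (hw : Continuous w) (hw0 : ∀ x, 0 ≤ w x) (h : ℝ → ℝ) :
    ∫ x, h x ∂(μ.withDensity fun x => ENNReal.ofReal (w x)) = ∫ x, w x * h x ∂μ := by
  rw [integral_withDensity_eq_integral_toReal_smul hw.measurable.ennreal_ofReal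
    (.of_forall fun x => ENNReal.ofReal_lt_top)]
  simp [ENNReal.toReal_ofReal (hw0 _)]

lemma isProbabilityMeasure_withDensity_ofReal (hw0 : ∀ x, 0 ≤ w x)
    (hi : Integrable w μ) (h1 : ∫ x, w x ∂μ = 1) :
    IsProbabilityMeasure (μ.withDensity fun x => ENNReal.ofReal (w x)) := by
  constructor
  rw [withDensity_apply _ MeasurableSet.univ, Measure.restrict_univ,
    ← ofReal_integral_eq_lintegral_ofReal hi (.of_forall hw0), h1, ENNReal.ofReal_one]

lemma ae_withDensity_mem_Icc {A : ℝ} (hμ : ∀ᵐ x ∂μ, x ∈ Set.Icc (-A) A) (v : ℝ → ENNReal) :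
    ∀ᵐ x ∂(μ.withDensity v), x ∈ Set.Icc (-A) A :=
  (withDensity_absolutelyContinuous μ v).ae_le hμ

lemma mul_log_perturb_le {f q t K : ℝ} (hf : 0 < f) (hq0 : 0 ≤ q) (hq : q ≤ K * f) (hK : 0 ≤ K)
    (ht : 0 < t) (htK : t * (K + 1) ≤ 1 / 2) :
    ((1 + t) * f - t * q) * Real.log ((1 + t) * f - t * q) ≤
      ((1 + t) * Real.log f + (t + t ^ 2 * (K + 1) ^ 2)) * f + (-t * Real.log f - t) * q := by
  have hg : 0 < (1 + t) * f - t * q := by nlinarith [mul_le_mul_of_nonneg_left hq ht.le]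
  have hlog := Real.log_le_sub_one_of_pos (div_pos hg hf)
  rw [Real.log_div hg.ne' hf.ne'] at hlog
  obtain ⟨r, rfl⟩ : ∃ r, q = r * f := ⟨q / f, by field_simp⟩
  have hr0 : 0 ≤ r := nonneg_of_mul_nonneg_left hq0 hf
  have hrK : r ≤ K := le_of_mul_le_mul_right hq hf
  have e : ((1 + t) * f - t * (r * f)) / f - 1 = t * (1 - r) := by field_simp; ring
  rw [e] at hlog
  have h2 := mul_le_mul_of_nonneg_left hlog hg.le
  have h3 : (1 - r) ^ 2 ≤ (K + 1) ^ 2 := by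
    apply sq_le_sq'  <;> linarith
  have h4 := mul_le_mul_of_nonneg_left h3 (by positivity : 0 ≤ t ^ 2 * f)
  nlinarith

lemma outDen_withDensity (hw : Continuous w) (hw0 : ∀ x, 0 ≤ w x) (y : ℝ) :
    outDen (μ.withDensity fun x => ENNReal.ofReal (w x)) y =
      ∫ x, w x * stdNormalPdf (y - x) ∂μ :=
  integral_withDensity_ofReal hw hw0 _

lemma integral_outDen_mul_log_le_of_optimal [IsProbabilityMeasure μ] {A : ℝ}
    (hμ : ∀ᵐ x ∂μ, x ∈ Set.Icc (-A) A)
    (hopt : ∀ Q : Measure ℝ, IsProbabilityMeasure Q → (∀ᵐ x ∂Q, x ∈ Set.Icc (-A) A) →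
      awgnMI Q ≤ awgnMI μ)
    (Q : Measure ℝ) [IsProbabilityMeasure Q] (hQ : ∀ᵐ x ∂Q, x ∈ Set.Icc (-A) A) :
    ∫ y, outDen μ y * Real.log (outDen μ y) ≤ ∫ y, outDen Q y * Real.log (outDen Q y) := by
  have := hopt Q inferInstance hQ
  rw [awgnMI_eq hμ, awgnMI_eq hQ] at this
  linarith

/-- First-order optimality of a capacity-achieving input along reweightings of that input. -/
lemma integral_reweighted_outDen_mul_log_le [IsProbabilityMeasure μ] {A : ℝ}
    (hμ : ∀ᵐ x ∂μ, x ∈ Set.Icc (-A) A)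
    (hopt : ∀ Q : Measure ℝ, IsProbabilityMeasure Q → (∀ᵐ x ∂Q, x ∈ Set.Icc (-A) A) →
      awgnMI Q ≤ awgnMI μ)
    (hw : Continuous w) (hw0 : ∀ x, 0 ≤ w x) {K : ℝ} (hwK : ∀ x, w x ≤ K)
    (hw1 : ∫ x, w x ∂μ = 1) :
    ∫ y, outDen (μ.withDensity fun x => ENNReal.ofReal (w x)) y * Real.log (outDen μ y) ≤
      ∫ y, outDen μ y * Real.log (outDen μ y) := by
  have hK : 0 ≤ K := (hw0 0).trans (hwK 0)
  have hwi := integrable_of_continuous_of_ae_mem_Icc hμ hw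
  have hQp := isProbabilityMeasure_withDensity_ofReal hw0 hwi hw1
  have hQs := ae_withDensity_mem_Icc hμ (fun x => ENNReal.ofReal (w x))
  set Q := μ.withDensity fun x => ENNReal.ofReal (w x)
  have hqw : ∀ y, outDen Q y = ∫ x, w x * stdNormalPdf (y - x) ∂μ := outDen_withDensity hw hw0
  have hc := continuous_log_outDen hμ
  have hb := abs_log_outDen_le hμ
  have hqK : ∀ y, outDen Q y ≤ K * outDen μ y := by
    intro y
    rw [hqw, outDen, ← integral_const_mul]
    exact integral_mono
      (integrable_of_continuous_of_ae_mem_Icc hμ (hw.mul (continuous_stdNormalPdf_sub y)))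
      ((integrable_stdNormalPdf_sub μ y).const_mul K)
      (fun x => mul_le_mul_of_nonneg_right (hwK x) (stdNormalPdf_pos _).le)
  set J := ∫ y, outDen μ y * Real.log (outDen μ y)
  set L := ∫ y, outDen Q y * Real.log (outDen μ y)
  have key : ∀ t : ℝ, 0 < t → t * (K + 1) ≤ 1 / 2 → L ≤ J + t * (K + 1) ^ 2 := by
    intro t ht htK
    have hv : Continuous fun x => (1 + t) - t * w x := by fun_prop
    have hv0 : ∀ x, 0 ≤ (1 + t) - t * w x := fun x => by
      nlinarith [mul_le_mul_of_nonneg_left (hwK x) ht.le]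
    have hv1 : ∫ x, ((1 + t) - t * w x) ∂μ = 1 := by
      rw [integral_sub (integrable_const _) (hwi.const_mul t), integral_const_mul, hw1]
      simp
    have hRp := isProbabilityMeasure_withDensity_ofReal hv0
      (integrable_of_continuous_of_ae_mem_Icc hμ hv) hv1
    have hRs := ae_withDensity_mem_Icc hμ (fun x => ENNReal.ofReal ((1 + t) - t * w x))
    have hfR := fun y => outDen_withDensity (μ := μ) hv hv0 y
    set R := μ.withDensity fun x => ENNReal.ofReal ((1 + t) - t * w x)
    have hR : ∀ y, outDen R y = (1 + t) * outDen μ y - t * outDen Q y := by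
      intro y
      have hwφ : Integrable (fun x => w x * stdNormalPdf (y - x)) μ :=
        integrable_of_continuous_of_ae_mem_Icc hμ (hw.mul (continuous_stdNormalPdf_sub y))
      rw [hfR, hqw, outDen, ← integral_const_mul, ← integral_const_mul, ← integral_sub
        ((integrable_stdNormalPdf_sub μ y).const_mul _) (hwφ.const_mul t)]
      congr 1 with x
      ring
    have h1 := integral_outDen_mul_log_le_of_optimal hμ hopt R hRs
    have i1 := integrable_outDen_mul hμ hc hb
    have i2 := integrable_outDen_mul hQs hc hb
    have i3 := integrable_outDen hμ
    have i4 := integrable_outDen hQs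
    have j1 : Integrable fun y => (1 + t) * (outDen μ y * Real.log (outDen μ y)) +
        (t + t ^ 2 * (K + 1) ^ 2) * outDen μ y := (i1.const_mul _).add (i3.const_mul _)
    have j2 : Integrable fun y => t * (outDen Q y * Real.log (outDen μ y)) + t * outDen Q y :=
      (i2.const_mul _).add (i4.const_mul _)
    have h2 : ∫ y, outDen R y * Real.log (outDen R y) ≤
        ∫ y, (((1 + t) * (outDen μ y * Real.log (outDen μ y)) +
          (t + t ^ 2 * (K + 1) ^ 2) * outDen μ y) -
          (t * (outDen Q y * Real.log (outDen μ y)) + t * outDen Q y)) := by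
      refine integral_mono
        (integrable_outDen_mul hRs (continuous_log_outDen hRs) (abs_log_outDen_le hRs))
        (j1.sub j2)
        (fun y => ?_)
      have := mul_log_perturb_le (outDen_pos hμ y) (outDen_pos hQs y).le (hqK y) hK ht htK
      simp only [hR]
      linarith
    rw [integral_sub j1 j2, integral_add (i1.const_mul _) (i3.const_mul _),
      integral_add (i2.const_mul _) (i4.const_mul _), integral_const_mul, integral_const_mul,
      integral_const_mul, integral_const_mul, integral_outDen hμ, integral_outDen hQs] at h2
    have h3 : t * L ≤ t * (J + t * (K + 1) ^ 2) := by nlinarith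
    exact le_of_mul_le_mul_left h3 ht
  refine le_of_forall_pos_le_add fun ε hε => ?_
  have hpos : 0 < min (1 / (2 * (K + 1))) (ε / (K + 1) ^ 2) := by positivity
  refine (key _ hpos ?_).trans ?_
  · calc _ ≤ 1 / (2 * (K + 1)) * (K + 1) := by gcongr; exact min_le_left _ _
      _ = 1 / 2 := by field_simp
  · have : min (1 / (2 * (K + 1))) (ε / (K + 1) ^ 2) * (K + 1) ^ 2 ≤
        ε / (K + 1) ^ 2 * (K + 1) ^ 2 := by gcongr; exact min_le_right _ _
    rw [div_mul_cancel₀ _ (by positivity)] at this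
    linarith

end Reweighting

lemma outDen_le_mul_exp_of_le {μ : Measure ℝ} [IsFiniteMeasure μ] {A : ℝ}
    (hμ : ∀ᵐ x ∂μ, x ∈ Set.Icc (-A) A) {y : ℝ} (hy : A ≤ y) :
    outDen μ y ≤ outDen μ A * Real.exp (-(y - A) ^ 2 / 2) := by
  rw [outDen, outDen, ← integral_mul_const]
  refine integral_mono_ae (integrable_stdNormalPdf_sub μ y)
    ((integrable_stdNormalPdf_sub μ A).mul_const _) ?_
  filter_upwards [hμ] with x hx
  rw [stdNormalPdf_eq_mul_exp (y - x) (A - x)]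
  have := stdNormalPdf_pos (A - x)
  gcongr
  nlinarith [mul_nonneg (sub_nonneg.2 hy) (sub_nonneg.2 hx.2)]

lemma outDen_le_mul_exp_of_le_neg {μ : Measure ℝ} [IsFiniteMeasure μ] {A : ℝ}
    (hμ : ∀ᵐ x ∂μ, x ∈ Set.Icc (-A) A) {y : ℝ} (hy : y ≤ -A) :
    outDen μ y ≤ outDen μ (-A) * Real.exp (-(y + A) ^ 2 / 2) := by
  rw [outDen, outDen, ← integral_mul_const]
  refine integral_mono_ae (integrable_stdNormalPdf_sub μ y)
    ((integrable_stdNormalPdf_sub μ (-A)).mul_const _) ?_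
  filter_upwards [hμ] with x hx
  rw [stdNormalPdf_eq_mul_exp (y - x) (-A - x)]
  have := stdNormalPdf_pos (-A - x)
  gcongr
  nlinarith [mul_nonneg (sub_nonneg.2 hy) (sub_nonneg.2 hx.1)]

lemma exists_forall_outDen_le {μ : Measure ℝ} [IsProbabilityMeasure μ] {A : ℝ} (hA : 0 < A)
    (hμ : ∀ᵐ x ∂μ, x ∈ Set.Icc (-A) A) : ∃ y₀, ∀ y, outDen μ y ≤ outDen μ y₀ := by
  obtain ⟨y₀, -, hmax⟩ := isCompact_Icc.exists_isMaxOn (s := Set.Icc (-A) A) ⟨0, by simp [hA.le]⟩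
    (continuous_outDen μ).continuousOn
  refine ⟨y₀, fun y => ?_⟩
  have hexp : ∀ z : ℝ, Real.exp (-z ^ 2 / 2) ≤ 1 := fun z =>
    Real.exp_le_one_iff.2 (by nlinarith [sq_nonneg z])
  rcases le_total A y with h | h
  · refine (outDen_le_mul_exp_of_le hμ h).trans ?_
    exact (mul_le_of_le_one_right (outDen_pos hμ _).le (hexp _)).trans
      (hmax (show A ∈ Set.Icc (-A) A by simp [hA.le]))
  rcases le_total y (-A) with h' | h'
  · refine (outDen_le_mul_exp_of_le_neg hμ h').trans ?_
    exact (mul_le_of_le_one_right (outDen_pos hμ _).le (hexp _)).trans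
      (hmax (show -A ∈ Set.Icc (-A) A by simp [hA.le]))
  · exact hmax ⟨h', h⟩

lemma one_add_sq_div_two_le_cosh (z : ℝ) : 1 + z ^ 2 / 2 ≤ Real.cosh z := by
  have h : (z / 2) ^ 2 ≤ Real.sinh (z / 2) ^ 2 := by
    rw [sq_le_sq]
    rcases le_total 0 (z / 2) with hz | hz
    · have := Real.self_le_sinh_iff.2 hz
      rwa [abs_of_nonneg hz, abs_of_nonneg (hz.trans this)]
    · have := Real.sinh_le_self_iff.2 hz
      rw [abs_of_nonpos hz, abs_of_nonpos (this.trans hz)]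
      linarith
  have e : Real.cosh z = Real.cosh (z / 2) ^ 2 + Real.sinh (z / 2) ^ 2 := by
    rw [← Real.cosh_two_mul]; ring_nf
  rw [e, Real.cosh_sq]
  nlinarith

/-- At a maximum of the output density the posterior second moment about that point is at most the
noise variance. -/
lemma integral_stdNormalPdf_sub_mul_sq_le {μ : Measure ℝ} [IsProbabilityMeasure μ] {A : ℝ}
    (hμ : ∀ᵐ x ∂μ, x ∈ Set.Icc (-A) A) {y₀ : ℝ} (hmax : ∀ y, outDen μ y ≤ outDen μ y₀) :
    ∫ x, stdNormalPdf (y₀ - x) * (y₀ - x) ^ 2 ∂μ ≤ outDen μ y₀ := by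
  set W := ∫ x, stdNormalPdf (y₀ - x) * (y₀ - x) ^ 2 ∂μ
  have hf := outDen_pos hμ y₀
  have hWi : Integrable (fun x => stdNormalPdf (y₀ - x) * (y₀ - x) ^ 2) μ :=
    integrable_of_continuous_of_ae_mem_Icc hμ
      ((continuous_stdNormalPdf_sub y₀).mul (by fun_prop))
  have hfi := integrable_stdNormalPdf_sub μ y₀
  have key : ∀ ε : ℝ, outDen μ y₀ + ε ^ 2 / 2 * W ≤ outDen μ y₀ * Real.exp (ε ^ 2 / 2) := by
    intro ε
    have h1 : ∫ x, (stdNormalPdf (y₀ - x) +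
        ε ^ 2 / 2 * (stdNormalPdf (y₀ - x) * (y₀ - x) ^ 2)) ∂μ ≤
        ∫ x, (stdNormalPdf (y₀ + ε - x) + stdNormalPdf (y₀ - ε - x)) *
          (Real.exp (ε ^ 2 / 2) / 2) ∂μ := by
      refine integral_mono (hfi.add (hWi.const_mul _))
        (((integrable_stdNormalPdf_sub μ (y₀ + ε)).add
          (integrable_stdNormalPdf_sub μ (y₀ - ε))).mul_const _) (fun x => ?_)
      have e : (stdNormalPdf (y₀ + ε - x) + stdNormalPdf (y₀ - ε - x)) *
          (Real.exp (ε ^ 2 / 2) / 2) = stdNormalPdf (y₀ - x) * Real.cosh (ε * (y₀ - x)) := by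
        rw [stdNormalPdf_eq_mul_exp (y₀ + ε - x) (y₀ - x),
          stdNormalPdf_eq_mul_exp (y₀ - ε - x) (y₀ - x), Real.cosh_eq,
          show ε * (y₀ - x) = ((y₀ - x) ^ 2 - (y₀ - ε - x) ^ 2) / 2 + ε ^ 2 / 2 by ring,
          show -(((y₀ - x) ^ 2 - (y₀ - ε - x) ^ 2) / 2 + ε ^ 2 / 2) =
            ((y₀ - x) ^ 2 - (y₀ + ε - x) ^ 2) / 2 + ε ^ 2 / 2 by ring, Real.exp_add, Real.exp_add]
        ring
      have h2 := mul_le_mul_of_nonneg_left (one_add_sq_div_two_le_cosh (ε * (y₀ - x)))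
        (stdNormalPdf_pos (y₀ - x)).le
      simp only [e]
      linarith
    rw [integral_add hfi (hWi.const_mul _), integral_const_mul, integral_mul_const,
      integral_add (integrable_stdNormalPdf_sub μ (y₀ + ε))
        (integrable_stdNormalPdf_sub μ (y₀ - ε))] at h1
    have h3 : outDen μ (y₀ + ε) + outDen μ (y₀ - ε) ≤ 2 * outDen μ y₀ := by
      linarith [hmax (y₀ + ε), hmax (y₀ - ε)]
    have h4 := mul_le_mul_of_nonneg_right h3
      (by positivity : 0 ≤ Real.exp (ε ^ 2 / 2) / 2)
    simp only [outDen] at h4 h1 ⊢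
    linarith
  refine le_of_forall_pos_le_add fun δ hδ => ?_
  set s := min 1 (δ / outDen μ y₀)
  have hs0 : 0 < s := by positivity
  have hs1 : s ≤ 1 := min_le_left _ _
  have hsδ : s * outDen μ y₀ ≤ δ := (le_div_iff₀ hf).1 (min_le_right _ _)
  have h5 := key (√(2 * s))
  rw [Real.sq_sqrt (by positivity), mul_div_cancel_left₀ _ two_ne_zero] at h5
  have h6 := (abs_le.1 (Real.abs_exp_sub_one_sub_id_le (abs_le.2 ⟨by linarith, hs1⟩))).2
  have h7 := mul_le_mul_of_nonneg_left h6 hf.le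
  have h8 : s * W ≤ s * (outDen μ y₀ + s * outDen μ y₀) := by nlinarith
  linarith [le_of_mul_le_mul_left h8 hs0]

lemma log_outDen_ge {μ : Measure ℝ} [IsProbabilityMeasure μ] {A : ℝ}
    (hμ : ∀ᵐ x ∂μ, x ∈ Set.Icc (-A) A) {y₀ m : ℝ}
    (hm : ∫ x, stdNormalPdf (y₀ - x) * x ∂μ = m * outDen μ y₀) (u : ℝ) :
    Real.log (outDen μ y₀) + ((y₀ ^ 2 - u ^ 2) / 2 + (u - y₀) * m) ≤ Real.log (outDen μ u) := by
  set c := (y₀ ^ 2 - u ^ 2) / 2 + (u - y₀) * m with hc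
  have hf := outDen_pos hμ y₀
  have hfi := integrable_stdNormalPdf_sub μ y₀
  have hmi : Integrable (fun x => stdNormalPdf (y₀ - x) * x) μ :=
    integrable_of_continuous_of_ae_mem_Icc hμ ((continuous_stdNormalPdf_sub y₀).mul continuous_id)
  have h1 : ∫ x, Real.exp c * ((1 - (u - y₀) * m) * stdNormalPdf (y₀ - x) +
      (u - y₀) * (stdNormalPdf (y₀ - x) * x)) ∂μ ≤ outDen μ u := by
    refine integral_mono (((hfi.const_mul _).add (hmi.const_mul _)).const_mul _)
      (integrable_stdNormalPdf_sub μ u) (fun x => ?_)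
    have h2 : stdNormalPdf (u - x) =
        stdNormalPdf (y₀ - x) * (Real.exp c * Real.exp ((u - y₀) * (x - m))) := by
      rw [stdNormalPdf_eq_mul_exp (u - x) (y₀ - x), ← Real.exp_add]
      congr 2
      rw [hc]; ring
    have h3 := mul_le_mul_of_nonneg_left (Real.add_one_le_exp ((u - y₀) * (x - m)))
      (mul_pos (stdNormalPdf_pos (y₀ - x)) (Real.exp_pos c)).le
    simp only [h2]
    linarith
  rw [integral_const_mul, integral_add (hfi.const_mul _) (hmi.const_mul _), integral_const_mul,
    integral_const_mul, hm] at h1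
  have h4 : Real.exp c * outDen μ y₀ ≤ outDen μ u := by
    refine le_trans (le_of_eq ?_) h1
    simp only [outDen]
    ring
  have h5 := Real.log_le_log (by positivity) h4
  rw [Real.log_mul (Real.exp_pos c).ne' hf.ne', Real.log_exp] at h5
  linarith

lemma log_two_mul_le_of_optimal {μ : Measure ℝ} [IsProbabilityMeasure μ] {A : ℝ} (hA : 0 < A)
    (hμ : ∀ᵐ x ∂μ, x ∈ Set.Icc (-A) A)
    (hopt : ∀ Q : Measure ℝ, IsProbabilityMeasure Q → (∀ᵐ x ∂Q, x ∈ Set.Icc (-A) A) →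
      awgnMI Q ≤ awgnMI μ) :
    ∫ y, outDen μ y * Real.log (outDen μ y) ≤ -Real.log (2 * A) := by
  set U : Measure ℝ := ENNReal.ofReal (1 / (2 * A)) • volume.restrict (Set.Icc (-A) A) with hU
  have hUs : ∀ᵐ x ∂U, x ∈ Set.Icc (-A) A :=
    Measure.ae_smul_measure (ae_restrict_mem measurableSet_Icc) _
  have hUp : IsProbabilityMeasure U := by
    constructor
    rw [hU, Measure.smul_apply, Measure.restrict_apply_univ, Real.volume_Icc, smul_eq_mul,
      ← ENNReal.ofReal_mul (by positivity), ← ENNReal.ofReal_one]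
    congr 1
    field_simp
    ring
  have hle : ∀ y, outDen U y ≤ 1 / (2 * A) := by
    intro y
    have hi : Integrable fun x => stdNormalPdf (y - x) := by
      have : Integrable stdNormalPdf := by
        simpa using integrable_stdNormalPdf_sub_mul 0 (F := fun _ => 1) continuous_const
          (a := 1) (b := 0) (by simp)
      exact this.comp_sub_left y
    have h1 : ∫ x in Set.Icc (-A) A, stdNormalPdf (y - x) ≤ ∫ x, stdNormalPdf (y - x) :=
      setIntegral_le_integral hi (.of_forall fun x => (stdNormalPdf_pos _).le)
    rw [integral_sub_left_eq_self stdNormalPdf volume y] at h1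
    have h2 := integral_stdNormalPdf_sub 0
    simp only [sub_zero] at h2
    rw [h2] at h1
    rw [outDen, hU, integral_smul_measure, ENNReal.toReal_ofReal (by positivity), smul_eq_mul]
    exact mul_le_of_le_one_right (by positivity) h1
  refine (integral_outDen_mul_log_le_of_optimal hμ hopt U hUs).trans ?_
  calc ∫ y, outDen U y * Real.log (outDen U y)
      ≤ ∫ y, outDen U y * (-Real.log (2 * A)) := by
        refine integral_mono
          (integrable_outDen_mul hUs (continuous_log_outDen hUs) (abs_log_outDen_le hUs))
          ((integrable_outDen hUs).mul_const _) (fun y => ?_)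
        refine mul_le_mul_of_nonneg_left ?_ (outDen_pos hUs y).le
        have := Real.log_le_log (outDen_pos hUs y) (hle y)
        rwa [one_div, Real.log_inv] at this
    _ = -Real.log (2 * A) := by rw [integral_mul_const, integral_outDen hUs, one_mul]

/-- Peak bound for the output density of a capacity-achieving input. -/
lemma outDen_le_of_optimal {μ : Measure ℝ} [IsProbabilityMeasure μ] {A : ℝ} (hA : 0 < A)
    (hμ : ∀ᵐ x ∂μ, x ∈ Set.Icc (-A) A)
    (hopt : ∀ Q : Measure ℝ, IsProbabilityMeasure Q → (∀ᵐ x ∂Q, x ∈ Set.Icc (-A) A) →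
      awgnMI Q ≤ awgnMI μ) (y : ℝ) :
    outDen μ y ≤ Real.exp 1 / (2 * A) := by
  obtain ⟨y₀, hmax⟩ := exists_forall_outDen_le hA hμ
  refine (hmax y).trans ?_
  have hf := outDen_pos hμ y₀
  set w : ℝ → ℝ := fun x => stdNormalPdf (y₀ - x) / outDen μ y₀ with hwdef
  have hw : Continuous w := (continuous_stdNormalPdf_sub y₀).div_const _
  have hw0 : ∀ x, 0 ≤ w x := fun x => (div_pos (stdNormalPdf_pos _) hf).le
  have hw1 : ∫ x, w x ∂μ = 1 := by
    rw [hwdef, integral_div]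
    exact div_self hf.ne'
  have hwK : ∀ x, w x ≤ 1 / outDen μ y₀ := fun x => by
    simp only [hwdef]
    gcongr
    exact stdNormalPdf_le_one _
  have hwi := integrable_of_continuous_of_ae_mem_Icc hμ hw
  have h1 := integral_reweighted_outDen_mul_log_le hμ hopt hw hw0 hwK hw1
  have h2 := log_two_mul_le_of_optimal hA hμ hopt
  have hQp := isProbabilityMeasure_withDensity_ofReal hw0 hwi hw1
  have hQs := ae_withDensity_mem_Icc hμ (fun x => ENNReal.ofReal (w x))
  have hQint := integral_withDensity_ofReal (μ := μ) hw hw0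
  set Q := μ.withDensity fun x => ENNReal.ofReal (w x)
  set m := ∫ x, x ∂Q with hm
  set s := ∫ x, x ^ 2 ∂Q
  have hmμ : ∫ x, stdNormalPdf (y₀ - x) * x ∂μ = m * outDen μ y₀ := by
    rw [hm, hQint, ← integral_mul_const]
    congr 1 with x
    simp only [hwdef]
    field_simp
  have hxi : Integrable (fun x : ℝ => x) Q :=
    integrable_of_continuous_of_ae_mem_Icc hQs continuous_id
  have hxi2 : Integrable (fun x : ℝ => x ^ 2) Q :=
    integrable_of_continuous_of_ae_mem_Icc hQs (continuous_pow 2)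
  have hsecond : y₀ ^ 2 - 2 * y₀ * m + s ≤ 1 := by
    have h3 := integral_stdNormalPdf_sub_mul_sq_le hμ hmax
    have h4 : ∫ x, (y₀ - x) ^ 2 ∂Q = (∫ x, stdNormalPdf (y₀ - x) * (y₀ - x) ^ 2 ∂μ) /
        outDen μ y₀ := by
      rw [hQint, ← integral_div]
      congr 1 with x
      simp only [hwdef]
      ring
    have h5 : ∫ x, (y₀ - x) ^ 2 ∂Q = y₀ ^ 2 - 2 * y₀ * m + s := by
      have e : ∀ x : ℝ, (y₀ - x) ^ 2 = y₀ ^ 2 + (-2 * y₀) * x + 1 * x ^ 2 := fun x => by ring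
      simp only [e]
      rw [integral_quadratic hxi hxi2]
      ring
    rw [← h5, h4]
    exact (div_le_one hf).2 h3
  set c := Real.log (outDen μ y₀) + y₀ ^ 2 / 2 - y₀ * m with hc
  have hFc : Continuous fun u : ℝ => c + m * u - u ^ 2 / 2 := by fun_prop
  have hFb : ∀ u : ℝ, |c + m * u - u ^ 2 / 2| ≤ (|c| + |m|) + (|m| + 1) * u ^ 2 := by
    intro u
    have hu : |u| ≤ 1 + u ^ 2 := by
      rw [← sq_abs u]; nlinarith [sq_nonneg (|u| - 1), abs_nonneg u]
    calc |c + m * u - u ^ 2 / 2| ≤ |c| + |m| * |u| + u ^ 2 / 2 := by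
          refine (abs_sub _ _).trans ?_
          rw [abs_of_nonneg (by positivity : 0 ≤ u ^ 2 / 2), ← abs_mul]
          gcongr
          exact abs_add_le _ _
      _ ≤ _ := by nlinarith [mul_le_mul_of_nonneg_left hu (abs_nonneg m), sq_nonneg u]
  have h6 : ∫ u, outDen Q u * (c + m * u - u ^ 2 / 2) ≤
      ∫ u, outDen Q u * Real.log (outDen μ u) := by
    refine integral_mono (integrable_outDen_mul hQs hFc hFb)
      (integrable_outDen_mul hQs (continuous_log_outDen hμ) (abs_log_outDen_le hμ)) (fun u => ?_)
    refine mul_le_mul_of_nonneg_left ?_ (outDen_pos hQs u).le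
    refine le_trans (le_of_eq ?_) (log_outDen_ge hμ hmμ u)
    rw [hc]; ring
  have h7 : ∫ u, outDen Q u * (c + m * u - u ^ 2 / 2) = c + m * m - (s + 1) / 2 := by
    rw [integral_outDen_mul hQs hFc hFb]
    simp only [integral_stdNormalPdf_sub_mul_quadratic]
    have e : ∀ x : ℝ, c + m * x - (x ^ 2 + 1) / 2 = (c - 1 / 2) + m * x + (-1 / 2) * x ^ 2 :=
      fun x => by ring
    simp only [e]
    rw [integral_quadratic hxi hxi2]
    ring
  have h8 : Real.log (outDen μ y₀) ≤ 1 - Real.log (2 * A) := by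
    nlinarith [sq_nonneg (y₀ - m)]
  calc outDen μ y₀ = Real.exp (Real.log (outDen μ y₀)) := (Real.exp_log hf).symm
    _ ≤ Real.exp (1 - Real.log (2 * A)) := Real.exp_le_exp.2 h8
    _ = Real.exp 1 / (2 * A) := by rw [Real.exp_sub, Real.exp_log (by positivity)]

lemma sum_range_exp_neg_mul_sq_le {b : ℝ} (hb : 0 < b) (n : ℕ) :
    ∑ i ∈ Finset.range n, Real.exp (-b * ((i : ℝ) + 1) ^ 2) ≤ √(π / b) / 2 := by
  have hanti : AntitoneOn (fun x : ℝ => Real.exp (-b * x ^ 2)) (Set.Icc 0 (0 + n)) := by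
    intro x hx y _ hxy
    apply Real.exp_le_exp.2
    have := pow_le_pow_left₀ hx.1 hxy 2
    nlinarith
  have h := hanti.sum_le_integral
  rw [← integral_gaussian_Ioi]
  have h' : ∑ i ∈ Finset.range n, Real.exp (-b * ((i : ℝ) + 1) ^ 2) ≤
      ∫ x in (0 : ℝ)..n, Real.exp (-b * x ^ 2) := by simpa using h
  refine h'.trans ?_
  rw [intervalIntegral.integral_of_le (by simp)]
  exact setIntegral_mono_set (integrable_exp_neg_mul_sq hb).integrableOn
    (.of_forall fun x => (Real.exp_pos _).le) Set.Ioc_subset_Ioi_self.eventuallyLE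

lemma summable_exp_neg_mul_sq {b : ℝ} (hb : 0 < b) :
    Summable fun i : ℕ => Real.exp (-b * (i : ℝ) ^ 2) := by
  rw [← summable_nat_add_iff 1]
  simpa using summable_of_sum_range_le (f := fun i : ℕ => Real.exp (-b * ((i : ℝ) + 1) ^ 2))
    (fun _ => (Real.exp_pos _).le) (sum_range_exp_neg_mul_sq_le hb)

lemma tsum_exp_neg_mul_sq_le {b : ℝ} (hb : 0 < b) :
    ∑' i : ℕ, Real.exp (-b * (i : ℝ) ^ 2) ≤ 1 + √(π / b) / 2 := by
  rw [(summable_exp_neg_mul_sq hb).tsum_eq_zero_add]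
  have := Real.tsum_le_of_sum_range_le
    (fun i => (Real.exp_pos (-b * ((i : ℝ) + 1) ^ 2)).le) (sum_range_exp_neg_mul_sq_le hb)
  simpa using this

lemma tsum_outDen_add_mul_le {μ : Measure ℝ} [IsProbabilityMeasure μ] {A M : ℝ} (hA : 0 < A)
    (hμ : ∀ᵐ x ∂μ, x ∈ Set.Icc (-A) A) (hM : ∀ y, outDen μ y ≤ M) {u : ℝ}
    (hu : u ∈ Set.Icc (-A) A) :
    ∑' k : ℤ, outDen μ (u + 2 * A * k) ≤ M * (3 + √(π / (2 * A ^ 2))) := by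
  have hM0 : 0 ≤ M := (outDen_pos hμ 0).le.trans (hM 0)
  have hb : 0 < 2 * A ^ 2 := by positivity
  have hS := (summable_exp_neg_mul_sq hb).mul_left M
  have hT := tsum_exp_neg_mul_sq_le hb
  have hpos : ∀ i : ℕ, outDen μ (u + 2 * A * ((i : ℝ) + 1)) ≤
      M * Real.exp (-(2 * A ^ 2) * (i : ℝ) ^ 2) := by
    intro i
    have hi : 0 ≤ 2 * A * (i : ℝ) := by positivity
    refine (outDen_le_mul_exp_of_le hμ (by linarith [hu.1])).trans ?_
    refine mul_le_mul (hM _) (Real.exp_le_exp.2 ?_) (Real.exp_pos _).le hM0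
    have : 2 * A * (i : ℝ) ≤ u + 2 * A * ((i : ℝ) + 1) - A := by linarith [hu.1]
    nlinarith [pow_le_pow_left₀ hi this 2]
  have hneg : ∀ i : ℕ, outDen μ (u + 2 * A * (-((i : ℝ) + 1))) ≤
      M * Real.exp (-(2 * A ^ 2) * (i : ℝ) ^ 2) := by
    intro i
    have hi : 0 ≤ 2 * A * (i : ℝ) := by positivity
    refine (outDen_le_mul_exp_of_le_neg hμ (by linarith [hu.2])).trans ?_
    refine mul_le_mul (hM _) (Real.exp_le_exp.2 ?_) (Real.exp_pos _).le hM0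
    have : 2 * A * (i : ℝ) ≤ -(u + 2 * A * (-((i : ℝ) + 1)) + A) := by linarith [hu.2]
    nlinarith [pow_le_pow_left₀ hi this 2]
  have s1 : Summable fun i : ℕ => outDen μ (u + 2 * A * ((i : ℝ) + 1)) :=
    hS.of_nonneg_of_le (fun i => (outDen_pos hμ _).le) hpos
  have s2 : Summable fun i : ℕ => outDen μ (u + 2 * A * (-((i : ℝ) + 1))) :=
    hS.of_nonneg_of_le (fun i => (outDen_pos hμ _).le) hneg
  have s0 : Summable fun i : ℕ => outDen μ (u + 2 * A * (i : ℝ)) := by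
    rw [← summable_nat_add_iff 1]
    simpa using s1
  have e := tsum_of_nat_of_neg_add_one (f := fun k : ℤ => outDen μ (u + 2 * A * k))
    (by simpa using s0) (by simpa using s2)
  push_cast at e
  rw [e, s0.tsum_eq_zero_add]
  have t1 := s1.tsum_le_tsum hpos hS
  have t2 := s2.tsum_le_tsum hneg hS
  rw [tsum_mul_left] at t1 t2
  have h3 := hM (u + 2 * A * ((0 : ℕ) : ℝ))
  have h4 := mul_le_mul_of_nonneg_left hT hM0
  push_cast at h3 ⊢
  linarith

theorem stmt_17 (A : ℝ) (hA : 1 < A)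
    (Pstar : Measure ℝ) [IsProbabilityMeasure Pstar]
    (hsupp : ∀ᵐ x ∂Pstar, x ∈ Set.Icc (-A) A)
    (hopt : ∀ Q : Measure ℝ, IsProbabilityMeasure Q → (∀ᵐ x ∂Q, x ∈ Set.Icc (-A) A) →
      awgnMI Q ≤ awgnMI Pstar)
    (g : ℝ → ℝ)
    (hg : ∀ θ, g θ = (A / π) * ∑' k : ℤ, outDen Pstar ((A / π) * (θ + 2 * π * k))) :
    (∀ θ ∈ Set.Ioo (-π) π, g θ ≤ (Real.exp 1 / (2 * π)) * (3 + Real.sqrt π / (Real.sqrt 2 * A))) ∧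
    (Real.exp 1 / (2 * π)) * (3 + Real.sqrt π / (Real.sqrt 2 * A)) ≤ 5 * Real.exp 1 / (2 * π) := by
  have hA0 : 0 < A := one_pos.trans hA
  refine ⟨fun θ hθ => ?_, ?_⟩
  · have hsqrt : √(π / (2 * A ^ 2)) = √π / (√2 * A) := by
      rw [Real.sqrt_div Real.pi_pos.le, Real.sqrt_mul two_pos.le, Real.sqrt_sq hA0.le]
    have hu : A / π * θ ∈ Set.Icc (-A) A := by
      rw [div_mul_eq_mul_div, Set.mem_Icc, le_div_iff₀ Real.pi_pos, div_le_iff₀ Real.pi_pos]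
      constructor <;> nlinarith [hθ.1, hθ.2]
    have h := tsum_outDen_add_mul_le hA0 hsupp (outDen_le_of_optimal hA0 hsupp hopt) hu
    have e : ∀ k : ℤ, A / π * (θ + 2 * π * k) = A / π * θ + 2 * A * k := fun k => by
      field_simp
    rw [hg]
    simp only [e]
    calc _ ≤ A / π * (Real.exp 1 / (2 * A) * (3 + √(π / (2 * A ^ 2)))) :=
          mul_le_mul_of_nonneg_left h (by positivity)
      _ = _ := by
          rw [hsqrt]
          field_simp
  · have h1 : √π / (√2 * A) ≤ 2 := by
      rw [div_le_iff₀ (by positivity)]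
      have h2 : √π ≤ 2 * √2 := by
        rw [Real.sqrt_le_left (by positivity), mul_pow, Real.sq_sqrt two_pos.le]
        linarith [Real.pi_le_four]
      nlinarith [Real.sqrt_nonneg 2]
    calc _ ≤ Real.exp 1 / (2 * π) * (3 + 2) := by gcongr
      _ = _ := by ring
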